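/- For every alpha in (0,1], the class DIM^alpha = {X : dim(X) = alpha} is Wadge complete for boldface Pi^0_3: every boldface Pi^0_3 subset of Cantor space is the preimage of DIM^alpha under some continuous function from Cantor space to Cantor space. Consequently DIM^alpha is not boldface Sigma^0_3. -/

import Mathlib

open Filter Topology

abbrev Cantor := ℕ → Bool

/-- The length-`n` prefix of an infinite binary sequence, as a list. -/
def pref (X : ℕ → Bool) (n : ℕ) : List Bool := (List.range n).map X

/-- A prefix-free machine: a partial computable map from programs (finite
binary strings) to strings, whose domain is an antichain under the prefix
relation. -/
def PFMachine (M : List Bool →. List Bool) : Prop :=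
  Partrec M ∧ ∀ p q : List Bool, (M p).Dom → (M q).Dom → p <+: q → p = q

/-- A universal prefix-free machine: a prefix-free machine simulating every
prefix-free machine with only a constant overhead in program length. -/
def UniversalPF (U : List Bool →. List Bool) : Prop :=
  PFMachine U ∧ ∀ M : List Bool →. List Bool, PFMachine M → ∃ c : ℕ,
    ∀ w p : List Bool, w ∈ M p → ∃ q : List Bool, w ∈ U q ∧ q.length ≤ p.length + c

/-- Prefix-free Kolmogorov complexity with respect to the machine `U`: the
length of a shortest program producing `w`. -/
noncomputable def K (U : List Bool →. List Bool) (w : List Bool) : ℕ :=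
  sInf {n : ℕ | ∃ p : List Bool, w ∈ U p ∧ p.length = n}

/-- `dimK U X = liminf_n K(X↾n)/n`, the (Kolmogorov characterization of the)
constructive dimension of the sequence `X`. -/
noncomputable def dimK (U : List Bool →. List Bool) (X : Cantor) : ℝ :=
  Filter.liminf (fun n : ℕ => (K U (pref X n) : ℝ) / n) Filter.atTop

/-- `DimK U X = limsup_n K(X↾n)/n`, the (Kolmogorov characterization of the)
constructive strong dimension of the sequence `X`. -/
noncomputable def DimK (U : List Bool →. List Bool) (X : Cantor) : ℝ :=
  Filter.limsup (fun n : ℕ => (K U (pref X n) : ℝ) / n) Filter.atTop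

/-- A boldface Π⁰₃ subset of Cantor space: a countable intersection of
countable unions of closed sets. -/
def BoldPi3 (A : Set Cantor) : Prop :=
  ∃ F : ℕ → ℕ → Set Cantor, (∀ n m, IsClosed (F n m)) ∧ A = ⋂ n, ⋃ m, F n m

/-- A boldface Σ⁰₃ subset of Cantor space: a countable union of countable
intersections of open sets. -/
def BoldSigma3 (A : Set Cantor) : Prop :=
  ∃ F : ℕ → ℕ → Set Cantor, (∀ n m, IsOpen (F n m)) ∧ A = ⋃ n, ⋂ m, F n m


/-- Parser of the block machine. -/
def parseP (len : ℕ → ℕ) (g : ℕ → List Bool → List Bool) (p : List Bool) :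
    Option (List Bool × List Bool) :=
  if p.idxOf false + 1 + len (p.idxOf false) ≤ p.length then
    some (p.drop (p.idxOf false + 1 + len (p.idxOf false)),
      g (p.idxOf false) ((p.drop (p.idxOf false + 1)).take (len (p.idxOf false))))
  else none

lemma parseP_primrec {len : ℕ → ℕ} {g : ℕ → List Bool → List Bool} (hl : Primrec len)
    (hg : Primrec₂ g) : Primrec (parseP len g) := by
  have ha : Primrec (fun p : List Bool => p.idxOf false) :=
    Primrec.list_idxOf.comp (Primrec.const false) Primrec.id
  have hla : Primrec (fun p : List Bool => len (p.idxOf false)) := hl.comp ha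
  have ha1 : Primrec (fun p : List Bool => p.idxOf false + 1) := Primrec.succ.comp ha
  have hs : Primrec (fun p : List Bool => p.idxOf false + 1 + len (p.idxOf false)) :=
    Primrec.nat_add.comp ha1 hla
  unfold parseP
  refine Primrec.ite (Primrec.nat_le.comp hs Primrec.list_length) ?_ (Primrec.const none)
  refine Primrec.option_some.comp (Primrec.pair ?_ ?_)
  · exact Primrec.list_drop.comp hs Primrec.id
  · exact hg.comp ha (Primrec.list_take.comp hla (Primrec.list_drop.comp ha1 Primrec.id))

/-- The block machine. -/
def blockM (U : List Bool →. List Bool) (len : ℕ → ℕ) (g : ℕ → List Bool → List Bool) :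
    List Bool →. List Bool :=
  fun p => (parseP len g p : Part (List Bool × List Bool)).bind
    (fun qs => (U qs.1).map (fun σ => σ ++ qs.2))

lemma blockM_dom {U : List Bool →. List Bool} {len : ℕ → ℕ} {g : ℕ → List Bool → List Bool}
    {p : List Bool} (h : (blockM U len g p).Dom) :
    p.idxOf false + 1 + len (p.idxOf false) ≤ p.length ∧
      (U (p.drop (p.idxOf false + 1 + len (p.idxOf false)))).Dom := by
  unfold blockM parseP at h
  split_ifs at h with h1
  · refine ⟨h1, ?_⟩
    simpa using h
  · simp at h

lemma blockM_PF {U : List Bool →. List Bool} (hU : PFMachine U)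
    {len : ℕ → ℕ} {g : ℕ → List Bool → List Bool} (hl : Primrec len)
    (hg : Primrec₂ g) : PFMachine (blockM U len g) := by
  constructor
  · unfold blockM
    refine Partrec.bind (Computable.ofOption (parseP_primrec hl hg).to_comp) ?_
    refine Partrec.map (hU.1.comp (Computable.fst.comp Computable.snd)) ?_
    exact Computable.list_append.comp Computable.snd
      (Computable.snd.comp (Computable.snd.comp Computable.fst))
  · intro p p' hp hp' hpp
    obtain ⟨h1, h2⟩ := blockM_dom hp
    obtain ⟨h1', h2'⟩ := blockM_dom hp'
    obtain ⟨t, rfl⟩ := hpp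
    have hmem : false ∈ p := by
      rw [← List.idxOf_lt_length_iff]; omega
    rw [List.idxOf_append_of_mem hmem] at h1' h2'
    have := hU.2 _ _ h2 h2' (by
      rw [List.drop_append_of_le_length h1]
      exact List.prefix_append _ _)
    rw [List.drop_append_of_le_length h1] at this
    have : t = [] := by simpa using this
    simp [this]

lemma blockM_simul {U : List Bool →. List Bool} (hU : UniversalPF U)
    {len : ℕ → ℕ} {g : ℕ → List Bool → List Bool} (hl : Primrec len)
    (hg : Primrec₂ g) : ∃ c : ℕ, ∀ σ q a τ, σ ∈ U q → τ.length = len a →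
      ∃ q', σ ++ g a τ ∈ U q' ∧ q'.length ≤ q.length + a + 1 + len a + c := by
  obtain ⟨c, hc⟩ := hU.2 _ (blockM_PF hU.1 hl hg)
  refine ⟨c, fun σ q a τ hq hτ => ?_⟩
  have hidx : (List.replicate a true ++ false :: (τ ++ q)).idxOf false = a := by
    rw [List.idxOf_append_of_notMem (by simp)]
    simp
  obtain ⟨q', h1, h2⟩ := hc (σ ++ g a τ) (List.replicate a true ++ false :: (τ ++ q)) (by
    unfold blockM parseP
    rw [hidx]
    rw [if_pos (by simp [hτ]; omega)]
    have e1 : (List.replicate a true ++ false :: (τ ++ q)).drop (a+1) = τ ++ q := by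
      rw [List.drop_append]; simp
    have e2 : (List.replicate a true ++ false :: (τ ++ q)).drop (a+1+len a) = q := by
      rw [← List.drop_drop, e1, ← hτ]; simp
    rw [e1, e2, ← hτ]
    simpa using hq)
  refine ⟨q', h1, h2.trans ?_⟩
  simp [hτ]; omega

lemma exists_nil {U : List Bool →. List Bool} (hU : UniversalPF U) : ∃ q, [] ∈ U q := by
  have : PFMachine (fun p => ((if p = [] then some [] else none : Option (List Bool)) :
      Part (List Bool))) := by
    constructor
    · apply Computable.ofOption
      exact (Primrec.ite (Primrec.eq.comp Primrec.id (Primrec.const [])) (Primrec.const _)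
        (Primrec.const _)).to_comp
    · intro p q hp hq _
      by_cases h : p = [] <;> by_cases h' : q = [] <;> simp_all
  obtain ⟨c, hc⟩ := hU.2 _ this
  obtain ⟨q, hq, -⟩ := hc [] [] (by simp)
  exact ⟨q, hq⟩

lemma K_le {U : List Bool →. List Bool} {w q : List Bool} (h : w ∈ U q) : K U w ≤ q.length :=
  Nat.sInf_le ⟨q, h, rfl⟩

/-- Appending a literal block of square length. -/
lemma append_rand {U : List Bool →. List Bool} (hU : UniversalPF U) :
    ∃ c : ℕ, ∀ σ q a τ, σ ∈ U q → τ.length = a * a →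
      ∃ q', σ ++ τ ∈ U q' ∧ q'.length ≤ q.length + a + 1 + a * a + c :=
  blockM_simul hU (len := fun a => a * a) (g := fun _ τ => τ)
    (Primrec.nat_mul.comp Primrec.id Primrec.id) Primrec₂.right

/-- Appending a block of zeros of square length. -/
lemma append_zero {U : List Bool →. List Bool} (hU : UniversalPF U) :
    ∃ c : ℕ, ∀ σ q a, σ ∈ U q →
      ∃ q', σ ++ List.replicate (a * a) false ∈ U q' ∧ q'.length ≤ q.length + a + 1 + c := by
  obtain ⟨c, hc⟩ := blockM_simul hU (len := fun _ => 0)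
    (g := fun a _ => (List.range (a * a)).map (fun _ => false))
    (Primrec.const 0) (by
      refine Primrec.list_map (Primrec.list_range.comp
        (Primrec.nat_mul.comp Primrec.fst Primrec.fst)) (Primrec.const false).to₂)
  refine ⟨c, fun σ q a h => ?_⟩
  simpa using hc σ q a [] h rfl

lemma exists_prog {U : List Bool →. List Bool} (hU : UniversalPF U) :
    ∃ C : ℕ, ∀ w, ∃ q, w ∈ U q ∧ q.length ≤ C * (w.length + 1) := by
  obtain ⟨c, hc⟩ := append_rand hU
  obtain ⟨q0, hq0⟩ := exists_nil hU
  refine ⟨q0.length + 3 + c, fun w => ?_⟩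
  induction w using List.reverseRecOn with
  | nil => exact ⟨q0, hq0, by simp; omega⟩
  | append_singleton w b ih =>
    obtain ⟨q, h1, h2⟩ := ih
    obtain ⟨q', h3, h4⟩ := hc w q 1 [b] h1 rfl
    refine ⟨q', h3, ?_⟩
    simp only [List.length_append, List.length_singleton]
    nlinarith

lemma K_bound {U : List Bool →. List Bool} (hU : UniversalPF U) :
    ∃ C : ℕ, ∀ w, K U w ≤ C * (w.length + 1) := by
  obtain ⟨C, hC⟩ := exists_prog hU
  refine ⟨C, fun w => ?_⟩
  obtain ⟨q, h1, h2⟩ := hC w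
  exact (K_le h1).trans h2

lemma K_attained {U : List Bool →. List Bool} (hU : UniversalPF U) (w : List Bool) :
    ∃ p, w ∈ U p ∧ p.length = K U w := by
  obtain ⟨C, hC⟩ := exists_prog hU
  obtain ⟨q, h1, h2⟩ := hC w
  exact Nat.sInf_mem (s := {n : ℕ | ∃ p : List Bool, w ∈ U p ∧ p.length = n}) ⟨_, q, h1, rfl⟩

lemma uniquely_decodable_of_antichain {S : Set (List Bool)}
    (h0 : [] ∉ S) (h : ∀ p ∈ S, ∀ q ∈ S, p <+: q → p = q) :
    InformationTheory.UniquelyDecodable S := by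
  intro L₁
  induction L₁ with
  | nil =>
    intro L₂ _ h2 he
    cases L₂ with
    | nil => rfl
    | cons a l =>
      exfalso
      have : a = [] := by
        have := congrArg List.length he
        simp only [List.flatten_cons, List.flatten_nil, List.length_append, List.length_nil] at this
        exact List.length_eq_zero_iff.1 (by omega)
      exact h0 (this ▸ h2 a (by simp))
  | cons a l ih =>
    intro L₂ h1 h2 he
    cases L₂ with
    | nil =>
      exfalso
      have : a = [] := by
        have := congrArg List.length he
        simp only [List.flatten_cons, List.flatten_nil, List.length_append, List.length_nil] at this
        exact List.length_eq_zero_iff.1 (by omega)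
      exact h0 (this ▸ h1 a (by simp))
    | cons b l' =>
      simp only [List.flatten_cons] at he
      have hab : a = b := by
        have ha : a <+: b ++ l'.flatten := he ▸ List.prefix_append _ _
        rcases List.prefix_or_prefix_of_prefix ha (List.prefix_append b _) with h3 | h3
        · exact h a (h1 a (by simp)) b (h2 b (by simp)) h3
        · exact (h b (h2 b (by simp)) a (h1 a (by simp)) h3).symm
      subst hab
      rw [ih l' (fun w hw => h1 w (by simp [hw])) (fun w hw => h2 w (by simp [hw]))
        (List.append_cancel_left he)]

lemma kraft_finset (S : Finset (List Bool))
    (h : ∀ p ∈ S, ∀ q ∈ S, p <+: q → p = q) :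
    ∑ p ∈ S, (1 / 2 : ℝ) ^ p.length ≤ 1 := by
  by_cases h0 : [] ∈ S
  · have : S = {[]} := by
      ext q
      constructor
      · intro hq
        simpa using (h [] h0 q hq List.nil_prefix).symm
      · intro hq
        simp at hq
        rwa [hq]
    simp [this]
  · have := InformationTheory.kraft_mcmillan_inequality (S := S)
      (uniquely_decodable_of_antichain (by simpa using h0) (by simpa using h))
    simpa using this

open Classical in
/-- Probability that the machine outputs an extension of `σ`. -/
noncomputable def mU (U : List Bool →. List Bool) (σ : List Bool) : ℝ :=
  ∑' p : List Bool, if (∃ w ∈ U p, σ <+: w) then (1 / 2 : ℝ) ^ p.length else 0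

open Classical in
lemma mU_sum_le {U : List Bool →. List Bool} (hU : PFMachine U) (σ : List Bool)
    (S : Finset (List Bool)) :
    ∑ p ∈ S, (if (∃ w ∈ U p, σ <+: w) then (1 / 2 : ℝ) ^ p.length else 0) ≤ 1 := by
  rw [← Finset.sum_filter]
  apply kraft_finset
  intro p hp q hq
  simp only [Finset.mem_filter] at hp hq
  obtain ⟨-, w, hw, -⟩ := hp
  obtain ⟨-, w', hw', -⟩ := hq
  exact hU.2 p q (Part.dom_iff_mem.2 ⟨w, hw⟩) (Part.dom_iff_mem.2 ⟨w', hw'⟩)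

open Classical in
lemma mU_summable {U : List Bool →. List Bool} (hU : PFMachine U) (σ : List Bool) :
    Summable (fun p : List Bool =>
      if (∃ w ∈ U p, σ <+: w) then (1 / 2 : ℝ) ^ p.length else 0) :=
  summable_of_sum_le (fun p => by positivity) (mU_sum_le hU σ)

lemma mU_le_one {U : List Bool →. List Bool} (hU : PFMachine U) (σ : List Bool) :
    mU U σ ≤ 1 :=
  (mU_summable hU σ).tsum_le_of_sum_le (mU_sum_le hU σ)

lemma mU_mono {U : List Bool →. List Bool} (hU : PFMachine U) {σ τ : List Bool}
    (h : σ <+: τ) : mU U τ ≤ mU U σ := by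
  refine (mU_summable hU τ).tsum_le_tsum (fun p => ?_) (mU_summable hU σ)
  split_ifs with h1 h2 h2
  · exact le_rfl
  · obtain ⟨w, hw, hw'⟩ := h1
    exact absurd ⟨w, hw, h.trans hw'⟩ h2
  · positivity
  · exact le_rfl

lemma mU_split {U : List Bool →. List Bool} (hU : PFMachine U) (σ : List Bool) :
    mU U (σ ++ [false]) + mU U (σ ++ [true]) ≤ mU U σ := by
  unfold mU
  rw [← (mU_summable hU _).tsum_add (mU_summable hU _)]
  refine ((mU_summable hU _).add (mU_summable hU _)).tsum_le_tsum (fun p => ?_) (mU_summable hU σ)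
  have key : ∀ b, (∃ w ∈ U p, σ ++ [b] <+: w) → ∃ w ∈ U p, σ <+: w := fun b ⟨w, h1, h2⟩ =>
    ⟨w, h1, (List.prefix_append _ _).trans h2⟩
  by_cases h1 : ∃ w ∈ U p, σ ++ [false] <+: w
  · by_cases h2 : ∃ w ∈ U p, σ ++ [true] <+: w
    · exfalso
      obtain ⟨w, hw, hw'⟩ := h1
      obtain ⟨v, hv, hv'⟩ := h2
      obtain rfl := Part.mem_unique hw hv
      have := List.prefix_of_prefix_length_le hw' hv' (by simp)
      simp at this
    · simp [h1, h2, key _ h1]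
  · by_cases h2 : ∃ w ∈ U p, σ ++ [true] <+: w
    · simp [h1, h2, key _ h2]
    · simp only [h1, h2, if_false, add_zero]
      split_ifs <;> positivity

lemma mU_bit {U : List Bool →. List Bool} (hU : PFMachine U) (σ : List Bool) :
    ∃ b, mU U (σ ++ [b]) ≤ mU U σ / 2 := by
  by_contra! h
  have := mU_split hU σ
  have h1 := h false
  have h2 := h true
  linarith

lemma mU_block {U : List Bool →. List Bool} (hU : PFMachine U) (σ : List Bool) (k : ℕ) :
    ∃ τ : List Bool, τ.length = k ∧ mU U (σ ++ τ) ≤ mU U σ * (1 / 2) ^ k := by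
  induction k with
  | zero => exact ⟨[], rfl, by simp⟩
  | succ k ih =>
    obtain ⟨τ, h1, h2⟩ := ih
    obtain ⟨b, hb⟩ := mU_bit hU (σ ++ τ)
    refine ⟨τ ++ [b], by simp [h1], ?_⟩
    rw [← List.append_assoc, pow_succ]
    linarith

lemma mU_K {U : List Bool →. List Bool} (hU : UniversalPF U) (σ : List Bool) {k : ℕ}
    (h : mU U σ ≤ (1 / 2) ^ k) : k ≤ K U σ := by
  obtain ⟨p, hp, hl⟩ := K_attained hU σ
  have h1 : (1 / 2 : ℝ) ^ p.length ≤ mU U σ := by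
    have := (mU_summable hU.1 σ).le_tsum p (fun q _ => by positivity)
    rw [if_pos ⟨σ, hp, List.prefix_rfl⟩] at this
    exact this
  rw [← hl]
  by_contra! hlt
  have h3 : (1 / 2 : ℝ) ^ k < (1 / 2) ^ p.length :=
    pow_lt_pow_right_of_lt_one₀ (by norm_num) (by norm_num) hlt
  linarith

/-- Total length of the first `s` blocks. -/
def nS : ℕ → ℕ
  | 0 => 0
  | s + 1 => nS s + (s + 1) * (s + 1)

lemma nS_formula (s : ℕ) : 6 * (nS s : ℝ) = s * (s + 1) * (2 * s + 1) := by
  induction s with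
  | zero => simp [nS]
  | succ s ih =>
    simp only [nS]
    push_cast
    linear_combination ih

lemma nS_ge (s : ℕ) : s ≤ nS s := by
  induction s with
  | zero => simp
  | succ s ih => simp only [nS]; nlinarith

lemma nS_mono : Monotone nS := monotone_nat_of_le_succ (fun s => by simp [nS])

lemma nS_small (C ε : ℝ) (hε : 0 < ε) : ∃ S : ℕ, ∀ s ≥ S, C * ((s : ℝ) + 1) ^ 2 ≤ ε * nS s := by
  obtain ⟨S, hS⟩ := exists_nat_ge (6 * C / ε)
  refine ⟨S, fun s hs => ?_⟩
  have h1 : 6 * C ≤ ε * s := by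
    rw [div_le_iff₀ hε] at hS
    have : (S : ℝ) ≤ s := by exact_mod_cast hs
    nlinarith
  have h2 : (s : ℝ) * ((s : ℝ) + 1) ^ 2 ≤ 6 * nS s := by
    rw [nS_formula]
    have : (0 : ℝ) ≤ s := by positivity
    nlinarith [mul_nonneg this this, mul_nonneg (mul_nonneg this this) this]
  have h3 : 6 * C * ((s : ℝ) + 1) ^ 2 ≤ ε * s * ((s : ℝ) + 1) ^ 2 :=
    mul_le_mul_of_nonneg_right h1 (by positivity)
  have h4 := mul_le_mul_of_nonneg_left h2 hε.le
  nlinarith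

/-- An incompressible block. -/
noncomputable def rblk {U : List Bool →. List Bool} (hU : PFMachine U) (σ : List Bool) (k : ℕ) :
    List Bool := (mU_block hU σ k).choose

/-- Target density at stage `s`. -/
noncomputable def tgt (α : ℝ) (v : ℕ) : ℝ := α * (1 - 1 / ((v : ℝ) + 2))

open Classical in
/-- The construction: current string and number of incompressible bits. -/
noncomputable def bld {U : List Bool →. List Bool} (hU : PFMachine U) (α : ℝ) (r : ℕ → ℕ) :
    ℕ → List Bool × ℕ
  | 0 => ([], 0)
  | s + 1 =>
    if ((bld hU α r s).2 : ℝ) < tgt α (r (Nat.log 2 s)) * nS s then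
      ((bld hU α r s).1 ++ rblk hU (bld hU α r s).1 ((s + 1) * (s + 1)),
        (bld hU α r s).2 + (s + 1) * (s + 1))
    else ((bld hU α r s).1 ++ List.replicate ((s + 1) * (s + 1)) false, (bld hU α r s).2)

section
variable {U : List Bool →. List Bool} (hU : PFMachine U) (α : ℝ) (r : ℕ → ℕ)

lemma bld_pos {s : ℕ} (h : ((bld hU α r s).2 : ℝ) < tgt α (r (Nat.log 2 s)) * nS s) :
    bld hU α r (s + 1) = ((bld hU α r s).1 ++ rblk hU (bld hU α r s).1 ((s + 1) * (s + 1)),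
        (bld hU α r s).2 + (s + 1) * (s + 1)) := by
  rw [bld, if_pos h]

lemma bld_neg {s : ℕ} (h : ¬ ((bld hU α r s).2 : ℝ) < tgt α (r (Nat.log 2 s)) * nS s) :
    bld hU α r (s + 1) =
      ((bld hU α r s).1 ++ List.replicate ((s + 1) * (s + 1)) false, (bld hU α r s).2) := by
  rw [bld, if_neg h]

lemma rblk_length (σ : List Bool) (k : ℕ) : (rblk hU σ k).length = k :=
  (mU_block hU σ k).choose_spec.1

lemma rblk_mU (σ : List Bool) (k : ℕ) : mU U (σ ++ rblk hU σ k) ≤ mU U σ * (1 / 2) ^ k :=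
  (mU_block hU σ k).choose_spec.2

lemma bld_length (s : ℕ) : (bld hU α r s).1.length = nS s := by
  induction s with
  | zero => rfl
  | succ s ih =>
    by_cases h : ((bld hU α r s).2 : ℝ) < tgt α (r (Nat.log 2 s)) * nS s
    · rw [bld_pos hU α r h]; simp [ih, nS, rblk_length]
    · rw [bld_neg hU α r h]; simp [ih, nS]

lemma bld_ext_succ (s : ℕ) : (bld hU α r s).1 <+: (bld hU α r (s + 1)).1 := by
  by_cases h : ((bld hU α r s).2 : ℝ) < tgt α (r (Nat.log 2 s)) * nS s
  · rw [bld_pos hU α r h]; simp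
  · rw [bld_neg hU α r h]; simp

lemma bld_ext {s t : ℕ} (h : s ≤ t) : (bld hU α r s).1 <+: (bld hU α r t).1 := by
  induction t, h using Nat.le_induction with
  | base => exact List.prefix_rfl
  | succ t _ ih => exact ih.trans (bld_ext_succ hU α r t)

lemma bld_mU (s : ℕ) : mU U (bld hU α r s).1 ≤ (1 / 2) ^ (bld hU α r s).2 := by
  induction s with
  | zero => simpa [bld] using mU_le_one hU []
  | succ s ih =>
    by_cases h : ((bld hU α r s).2 : ℝ) < tgt α (r (Nat.log 2 s)) * nS s
    · rw [bld_pos hU α r h]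
      refine (rblk_mU hU _ _).trans ?_
      rw [pow_add]
      exact mul_le_mul_of_nonneg_right ih (by positivity)
    · rw [bld_neg hU α r h]
      exact (mU_mono hU (List.prefix_append _ _)).trans ih

/-- The constructed sequence. -/
noncomputable def Yseq : Cantor := fun i => (bld hU α r (i + 1)).1.getD i false

lemma pref_length (X : Cantor) (n : ℕ) : (pref X n).length = n := by simp [pref]

lemma pref_mono (X : Cantor) {m n : ℕ} (h : m ≤ n) : pref X m <+: pref X n := by
  obtain ⟨k, rfl⟩ := Nat.exists_eq_add_of_le h
  unfold pref
  rw [List.range_add, List.map_append]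
  exact List.prefix_append _ _

lemma pref_Yseq (s : ℕ) : pref (Yseq hU α r) (nS s) = (bld hU α r s).1 := by
  apply List.ext_getElem
  · rw [pref_length, bld_length]
  · intro i h1 h2
    rw [bld_length] at h2
    have h3 : i < (bld hU α r (i+1)).1.length := by
      rw [bld_length]; exact nS_ge (i + 1)
    simp only [pref, Yseq, List.getElem_map, List.getElem_range]
    rw [List.getD_eq_getElem _ _ h3]
    rcases le_total s (i+1) with h | h
    · exact ((bld_ext hU α r h).getElem _).symm
    · exact (bld_ext hU α r h).getElem _

lemma tgt_le {α : ℝ} (hα : 0 < α) (v : ℕ) : tgt α v ≤ α := by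
  unfold tgt
  have : 0 ≤ 1 / ((v : ℝ) + 2) := by positivity
  nlinarith

lemma tgt_ge {α : ℝ} (hα : 0 < α) (v : ℕ) : α / 2 ≤ tgt α v := by
  unfold tgt
  have : 1 / ((v : ℝ) + 2) ≤ 1 / 2 := by
    apply one_div_le_one_div_of_le <;> norm_num
  nlinarith

lemma tgt_mono {α : ℝ} (hα : 0 < α) {v w : ℕ} (h : v ≤ w) : tgt α v ≤ tgt α w := by
  unfold tgt
  have : (v : ℝ) ≤ w := by exact_mod_cast h
  gcongr

variable {α}

lemma rho_upper (hα : 0 < α) (s : ℕ) :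
    ((bld hU α r s).2 : ℝ) ≤ α * nS s + (s : ℝ) ^ 2 := by
  induction s with
  | zero => simp [bld, nS]
  | succ s ih =>
    have hn : (0 : ℝ) ≤ nS s := by positivity
    by_cases h : ((bld hU α r s).2 : ℝ) < tgt α (r (Nat.log 2 s)) * nS s
    · rw [bld_pos hU α r h]
      have := mul_le_mul_of_nonneg_right (tgt_le hα (r (Nat.log 2 s))) hn
      simp only [nS]
      push_cast
      have : 0 ≤ α * (((s : ℝ) + 1) * (s + 1)) := by positivity
      nlinarith
    · rw [bld_neg hU α r h]
      simp only [nS]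
      push_cast
      have : 0 ≤ α * (((s : ℝ) + 1) * (s + 1)) := by positivity
      have : (0 : ℝ) ≤ s := by positivity
      nlinarith

lemma rho_epoch (hα : 0 < α) (t : ℕ) {s : ℕ} (h1 : 2 ^ t ≤ s) (h2 : s ≤ 2 ^ (t + 1)) :
    ((bld hU α r s).2 : ℝ) ≤ tgt α (r t) * nS s + (s : ℝ) ^ 2 ∨
      (bld hU α r s).2 = (bld hU α r (2 ^ t)).2 := by
  induction s, h1 using Nat.le_induction with
  | base => exact Or.inr rfl
  | succ s hs ih =>
    have hlog : Nat.log 2 s = t := Nat.log_eq_of_pow_le_of_lt_pow hs (by omega)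
    have hb : 0 < tgt α (r t) := by have := tgt_ge hα (r t); linarith
    have hp : 0 ≤ tgt α (r t) * (((s : ℝ) + 1) * (s + 1)) := by positivity
    have hs0 : (0 : ℝ) ≤ s := by positivity
    by_cases h : ((bld hU α r s).2 : ℝ) < tgt α (r (Nat.log 2 s)) * nS s
    · rw [bld_pos hU α r h]
      rw [hlog] at h
      left
      simp only [nS]
      push_cast
      nlinarith
    · rw [bld_neg hU α r h]
      rcases ih (by omega) with h3 | h3
      · left
        simp only [nS]
        push_cast
        nlinarith
      · right; exact h3

lemma rho_epoch_end (hα : 0 < α) (t : ℕ) :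
    ((bld hU α r (2 ^ (t + 1))).2 : ℝ) ≤
      tgt α (r t) * nS (2 ^ (t + 1)) + ((2 ^ (t + 1) : ℕ) : ℝ) ^ 2 := by
  rcases rho_epoch hU r hα t (Nat.pow_le_pow_right (by norm_num) (Nat.le_succ t)) le_rfl with h | h
  · exact h
  · rw [h]
    have h1 := rho_upper hU r hα (2 ^ t)
    have h2 : (2 : ℝ) * nS (2 ^ t) ≤ nS (2 ^ (t + 1)) := by
      have e1 := nS_formula (2 ^ t)
      have e2 := nS_formula (2 ^ (t + 1))
      push_cast at e1 e2
      have ep : (2 : ℝ) ^ (t + 1) = 2 * 2 ^ t := by ring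
      rw [ep] at e2
      set x : ℝ := 2 ^ t
      have hx : 0 < x := by positivity
      nlinarith [mul_pos hx hx, mul_pos (mul_pos hx hx) hx]
    have h3 := tgt_ge hα (r t)
    have h4 : (((2 ^ t : ℕ) : ℝ)) ^ 2 ≤ ((2 ^ (t + 1) : ℕ) : ℝ) ^ 2 := by
      push_cast
      gcongr
      · norm_num
      · omega
    have h5 : α * nS (2 ^ t) ≤ tgt α (r t) * nS (2 ^ (t + 1)) := by
      calc α * nS (2 ^ t) = (α / 2) * (2 * nS (2 ^ t)) := by ring
        _ ≤ tgt α (r t) * nS (2 ^ (t + 1)) :=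
          mul_le_mul h3 h2 (by positivity) (by linarith)
    linarith

lemma rho_lower {γ : ℝ} (hγ : γ ≤ 1) {S : ℕ} (h : ∀ s ≥ S, γ ≤ tgt α (r (Nat.log 2 s))) :
    ∀ s ≥ S, γ * nS s - nS S - (s : ℝ) ^ 2 ≤ (bld hU α r s).2 := by
  intro s hs
  induction s, hs using Nat.le_induction with
  | base =>
    have : γ * nS S ≤ 1 * nS S := by gcongr
    have : (0 : ℝ) ≤ (bld hU α r S).2 := by positivity
    nlinarith [sq_nonneg (S : ℝ)]
  | succ s hs ih =>
    have hn : (0 : ℝ) ≤ nS s := by positivity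
    have hS : (0 : ℝ) ≤ nS S := by positivity
    have hs0 : (0 : ℝ) ≤ s := by positivity
    have hg : γ * (((s : ℝ) + 1) * (s + 1)) ≤ 1 * (((s : ℝ) + 1) * (s + 1)) := by gcongr
    by_cases h' : ((bld hU α r s).2 : ℝ) < tgt α (r (Nat.log 2 s)) * nS s
    · rw [bld_pos hU α r h']
      simp only [nS]
      push_cast
      nlinarith
    · rw [bld_neg hU α r h']
      have := mul_le_mul_of_nonneg_right (h s hs) hn
      simp only [nS]
      push_cast
      nlinarith
end

lemma bld_K {U : List Bool →. List Bool} (hU : UniversalPF U) (α : ℝ) :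
    ∃ C : ℕ, ∀ r s, K U (bld hU.1 α r s).1 ≤ (bld hU.1 α r s).2 + C * (s + 1) ^ 2 := by
  obtain ⟨c1, hc1⟩ := append_rand hU
  obtain ⟨c2, hc2⟩ := append_zero hU
  obtain ⟨q0, hq0⟩ := exists_nil hU
  refine ⟨q0.length + c1 + c2 + 2, fun r s => ?_⟩
  have : ∃ q, (bld hU.1 α r s).1 ∈ U q ∧
      q.length ≤ (bld hU.1 α r s).2 + (q0.length + c1 + c2 + 2) * (s + 1) ^ 2 := by
    induction s with
    | zero => exact ⟨q0, by simpa [bld] using hq0, by simp [bld]; omega⟩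
    | succ s ih =>
      obtain ⟨q, hq, hl⟩ := ih
      by_cases h : ((bld hU.1 α r s).2 : ℝ) < tgt α (r (Nat.log 2 s)) * nS s
      · rw [bld_pos hU.1 α r h]
        obtain ⟨q', h1, h2⟩ := hc1 _ q (s + 1) _ hq (rblk_length hU.1 (bld hU.1 α r s).1 _)
        refine ⟨q', h1, h2.trans ?_⟩
        simp only
        nlinarith [Nat.zero_le (q0.length * s), Nat.zero_le (c1 * s), Nat.zero_le (c2 * s)]
      · rw [bld_neg hU.1 α r h]
        obtain ⟨q', h1, h2⟩ := hc2 _ q (s + 1) hq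
        refine ⟨q', h1, h2.trans ?_⟩
        simp only
        nlinarith [Nat.zero_le (q0.length * s), Nat.zero_le (c1 * s), Nat.zero_le (c2 * s)]
  obtain ⟨q, h1, h2⟩ := this
  exact (K_le h1).trans h2

lemma dimK_iff {U : List Bool →. List Bool} (hU : UniversalPF U) (X : Cantor) (α : ℝ) :
    dimK U X = α ↔
      (∀ k : ℕ, ∃ N, ∀ n ≥ N, α - 1 / ((k : ℝ) + 1) ≤ (K U (pref X n) : ℝ) / n) ∧
      (∀ k N : ℕ, ∃ n ≥ N, (K U (pref X n) : ℝ) / n ≤ α + 1 / ((k : ℝ) + 1)) := by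
  obtain ⟨C, hC⟩ := K_bound hU
  have hup : ∀ n : ℕ, (K U (pref X n) : ℝ) / n ≤ 2 * C := by
    intro n
    rcases Nat.eq_zero_or_pos n with rfl | hn
    · simp
    · rw [div_le_iff₀ (by positivity)]
      have h1 := hC (pref X n)
      rw [pref_length] at h1
      have h2 : C * (n + 1) ≤ 2 * C * n := by nlinarith
      exact_mod_cast h1.trans h2
  have hlo : ∀ n : ℕ, 0 ≤ (K U (pref X n) : ℝ) / n := fun n => by positivity
  have hb : IsBoundedUnder (· ≥ ·) atTop (fun n : ℕ => (K U (pref X n) : ℝ) / n) :=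
    isBoundedUnder_of ⟨0, hlo⟩
  have hb' : IsBoundedUnder (· ≤ ·) atTop (fun n : ℕ => (K U (pref X n) : ℝ) / n) :=
    isBoundedUnder_of ⟨_, hup⟩
  have hc := hb'.isCoboundedUnder_ge
  unfold dimK
  constructor
  · intro h
    constructor
    · intro k
      have : α - 1 / ((k : ℝ) + 1) <
          liminf (fun n : ℕ => (K U (pref X n) : ℝ) / n) atTop := by
        rw [h]; have : 0 < 1 / ((k : ℝ) + 1) := by positivity
        linarith
      have := eventually_lt_of_lt_liminf this hb
      obtain ⟨N, hN⟩ := eventually_atTop.1 this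
      exact ⟨N, fun n hn => (hN n hn).le⟩
    · intro k N
      have : liminf (fun n : ℕ => (K U (pref X n) : ℝ) / n) atTop < α + 1 / ((k : ℝ) + 1) := by
        rw [h]; have : 0 < 1 / ((k : ℝ) + 1) := by positivity
        linarith
      have := frequently_lt_of_liminf_lt hc this
      obtain ⟨n, hn, hn'⟩ := frequently_atTop.1 this N
      exact ⟨n, hn, hn'.le⟩
  · rintro ⟨h1, h2⟩
    apply le_antisymm
    · refine le_of_forall_pos_le_add (fun ε hε => ?_)
      obtain ⟨k, hk⟩ := exists_nat_one_div_lt hε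
      refine (liminf_le_of_frequently_le (frequently_atTop.2 (h2 k)) hb).trans (by linarith)
    · refine le_of_forall_pos_le_add (fun ε hε => ?_)
      obtain ⟨k, hk⟩ := exists_nat_one_div_lt hε
      have := le_liminf_of_le hc (eventually_atTop.2 (h1 k))
      linarith

lemma exists_block (n : ℕ) : ∃ s, nS s ≤ n ∧ n ≤ nS s + (s + 1) * (s + 1) := by
  induction n with
  | zero => exact ⟨0, by simp [nS]⟩
  | succ n ih =>
    obtain ⟨s, h1, h2⟩ := ih
    rcases h2.lt_or_eq with h | h
    · exact ⟨s, by omega, h⟩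
    · refine ⟨s + 1, ?_, ?_⟩
      · simp only [nS]; omega
      · simp only [nS]; rw [h]; nlinarith

lemma dimK_Yseq {U : List Bool →. List Bool} (hU : UniversalPF U) {α : ℝ}
    (hα : α ∈ Set.Ioc (0 : ℝ) 1) (r : ℕ → ℕ) :
    dimK U (Yseq hU.1 α r) = α ↔ ∀ v, ∃ T, ∀ t ≥ T, v < r t := by
  obtain ⟨hα0, hα1⟩ := hα
  obtain ⟨C, hC⟩ := bld_K hU α
  -- upper bound at block ends
  have hKup : ∀ (β ε : ℝ), 0 < ε → ∃ S, ∀ s ≥ S, 1 ≤ s →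
      ((bld hU.1 α r s).2 : ℝ) ≤ β * nS s + (s : ℝ) ^ 2 →
      (K U (pref (Yseq hU.1 α r) (nS s)) : ℝ) / (nS s : ℝ) ≤ β + ε := by
    intro β ε hε
    obtain ⟨S, hS⟩ := nS_small (C + 1) ε hε
    refine ⟨S, fun s hs hs1 h => ?_⟩
    have hpos : (0 : ℝ) < nS s := by
      have : 0 < nS s := lt_of_lt_of_le hs1 (nS_ge s)
      exact_mod_cast this
    rw [div_le_iff₀ hpos, pref_Yseq]
    have h1 : (K U (bld hU.1 α r s).1 : ℝ) ≤ (bld hU.1 α r s).2 + C * ((s : ℝ) + 1) ^ 2 := by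
      exact_mod_cast hC r s
    have h2 := hS s hs
    have : (0 : ℝ) ≤ s := by positivity
    nlinarith
  rw [dimK_iff hU]
  constructor
  · rintro ⟨hlow, -⟩ v
    by_contra! hcon
    have hd : 0 < α / ((v : ℝ) + 2) / 2 := by positivity
    obtain ⟨k, hk⟩ := exists_nat_one_div_lt hd
    obtain ⟨N, hN⟩ := hlow k
    obtain ⟨S, hS⟩ := hKup (tgt α v) _ hd
    obtain ⟨t, ht, hrt⟩ := hcon (max N S)
    have hts : t ≤ 2 ^ (t + 1) := (Nat.le_succ t).trans Nat.lt_two_pow_self.le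
    have hb := rho_epoch_end hU.1 r hα0 t
    have hm := tgt_mono hα0 hrt
    have h1 := hS (2 ^ (t + 1)) (by omega) Nat.one_le_two_pow
      (hb.trans (by gcongr))
    have h2 := hN (nS (2 ^ (t + 1))) (by have := nS_ge (2 ^ (t + 1)); omega)
    have h3 : tgt α v = α - α / ((v : ℝ) + 2) := by unfold tgt; ring
    rw [h3] at h1
    linarith
  · intro h
    constructor
    · intro k
      set ε : ℝ := 1 / ((k : ℝ) + 1) with hεd
      have hε : 0 < ε := by positivity
      obtain ⟨v, hv⟩ := exists_nat_gt (2 * α / ε)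
      obtain ⟨T, hT⟩ := h v
      have hγ : ∀ s ≥ 2 ^ T, α - ε / 2 ≤ tgt α (r (Nat.log 2 s)) := by
        intro s hs
        have hl : T ≤ Nat.log 2 s := Nat.le_log_of_pow_le (by norm_num) hs
        refine le_trans ?_ (tgt_mono hα0 (hT _ hl).le)
        have h3 : tgt α v = α - α / ((v : ℝ) + 2) := by unfold tgt; ring
        rw [h3]
        have : α / ((v : ℝ) + 2) ≤ ε / 2 := by
          rw [div_le_iff₀ (by positivity)]
          rw [div_lt_iff₀ hε] at hv
          nlinarith
        linarith
      have hlow := rho_lower hU.1 r (by linarith) hγ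
      obtain ⟨S, hS⟩ := nS_small (nS (2 ^ T) + 2) (ε / 2) (by positivity)
      refine ⟨nS (max (max S (2 ^ T)) 1) + 1 + (max (max S (2 ^ T)) 1 + 1) *
        (max (max S (2 ^ T)) 1 + 1), fun n hn => ?_⟩
      obtain ⟨s, hs1, hs2⟩ := exists_block n
      have hsm : max (max S (2 ^ T)) 1 ≤ s := by
        by_contra! hlt
        have := nS_mono hlt.le
        nlinarith
      have hn0 : (0 : ℝ) < n := by
        have : 0 < n := by omega
        exact_mod_cast this
      rw [le_div_iff₀ hn0]
      have hK : (bld hU.1 α r s).2 ≤ K U (pref (Yseq hU.1 α r) n) := by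
        apply mU_K hU
        refine le_trans ?_ (bld_mU hU.1 α r s)
        rw [← pref_Yseq]
        exact mU_mono hU.1 (pref_mono _ hs1)
      have hK' : ((bld hU.1 α r s).2 : ℝ) ≤ K U (pref (Yseq hU.1 α r) n) := by exact_mod_cast hK
      have h1 := hlow s (by omega)
      have h2 := hS s (by omega)
      have e1 : (nS s : ℝ) ≤ n := by exact_mod_cast hs1
      have e2 : (n : ℝ) ≤ nS s + ((s : ℝ) + 1) * (s + 1) := by exact_mod_cast hs2
      have e3 : (α - ε / 2) * (n - nS s) ≤ 1 * (n - nS s) :=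
        mul_le_mul_of_nonneg_right (by linarith) (by linarith)
      have e4 : (ε / 2) * nS s ≤ (ε / 2) * n := by gcongr
      have e5 : (nS (2 ^ T) : ℝ) ≤ nS (2 ^ T) * ((s : ℝ) + 1) ^ 2 := by
        apply le_mul_of_one_le_right (by positivity)
        have : (0 : ℝ) ≤ s := by positivity
        nlinarith
      have : (0 : ℝ) ≤ s := by positivity
      nlinarith
    · intro k N
      obtain ⟨S, hS⟩ := hKup α (1 / ((k : ℝ) + 1)) (by positivity)
      refine ⟨nS (max (max S N) 1), ?_, hS _ (by omega) (by omega) (rho_upper hU.1 r hα0 _)⟩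
      have := nS_ge (max (max S N) 1)
      omega

lemma isOpen_of_agree {s : Set Cantor}
    (h : ∀ x ∈ s, ∃ N : ℕ, ∀ y : Cantor, (∀ j < N, y j = x j) → y ∈ s) : IsOpen s := by
  rw [isOpen_iff_mem_nhds]
  intro x hx
  obtain ⟨N, hN⟩ := h x hx
  refine Filter.mem_of_superset
    ((PiNat.isOpen_cylinder (fun _ : ℕ => Bool) x N).mem_nhds (PiNat.self_mem_cylinder x N)) ?_
  intro y hy
  exact hN y (PiNat.mem_cylinder_iff.1 hy)

lemma pref_congr {x y : Cantor} {k : ℕ} (h : ∀ j < k, y j = x j) : pref y k = pref x k := by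
  unfold pref
  apply List.map_congr_left
  intro j hj
  exact h j (List.mem_range.1 hj)

lemma pref_eq_iff {x y : Cantor} {k : ℕ} : pref y k = pref x k ↔ ∀ j < k, y j = x j := by
  refine ⟨fun h j hj => ?_, pref_congr⟩
  simpa [pref] using List.map_inj_left.1 h j (List.mem_range.2 hj)

lemma isOpen_pref (P : List Bool → Prop) (n : ℕ) : IsOpen {X : Cantor | P (pref X n)} := by
  apply isOpen_of_agree
  intro x hx
  refine ⟨n, fun y hy => ?_⟩
  simp only [Set.mem_ofPred_eq] at hx ⊢
  rwa [pref_congr hy]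

lemma isClosed_pref (P : List Bool → Prop) (n : ℕ) : IsClosed {X : Cantor | P (pref X n)} := by
  rw [← isOpen_compl_iff]
  exact isOpen_pref (fun w => ¬ P w) n

/-- A Pi03 set that is not Sigma03. -/
lemma exists_pi3_not_sigma3 : ∃ A : Set Cantor, BoldPi3 A ∧ ¬ BoldSigma3 A := by
  classical
  let idx : ℕ → ℕ → List Bool → ℕ := fun n m w => Nat.pair n (Nat.pair m (Encodable.encode w))
  refine ⟨{x | ∀ n, ∃ m, ∀ k, x (idx n m (pref x k)) = false},
    ⟨fun n m => {x | ∀ k, x (idx n m (pref x k)) = false}, ?_, ?_⟩, ?_⟩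
  · intro n m
    rw [← isOpen_compl_iff]
    apply isOpen_of_agree
    intro x hx
    simp only [Set.mem_compl_iff, Set.mem_ofPred_eq, not_forall] at hx ⊢
    obtain ⟨k, hk⟩ := hx
    refine ⟨max k (idx n m (pref x k) + 1), fun y hy => ⟨k, ?_⟩⟩
    rw [pref_congr (fun j hj => hy j (by omega)), hy _ (by omega)]
    exact hk
  · ext x; simp
  · rintro ⟨G, hG, hA⟩
    let x : Cantor := fun j =>
      decide (∃ w : List Bool, Encodable.decode j.unpair.2.unpair.2 = some w ∧
        ∀ y : Cantor, pref y w.length = w → y ∈ G j.unpair.1 j.unpair.2.unpair.1)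
    have hx : ∀ n m w, x (idx n m w) = true ↔ ∀ y : Cantor, pref y w.length = w → y ∈ G n m := by
      intro n m w
      simp [x, idx]
    have key : ∀ n m, x ∈ G n m ↔ ∃ k, x (idx n m (pref x k)) = true := by
      intro n m
      constructor
      · intro h
        by_contra! hcon
        have : x ∉ (G n m)ᶜ := by simpa using h
        obtain ⟨k, hk⟩ := PiNat.exists_disjoint_cylinder (hG n m).isClosed_compl this
        apply hcon k
        rw [hx]
        intro y hy
        rw [pref_length, pref_eq_iff] at hy
        by_contra hyG
        exact Set.disjoint_left.1 hk hyG (PiNat.mem_cylinder_iff.2 hy)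
      · rintro ⟨k, hk⟩
        rw [hx] at hk
        exact hk x (by rw [pref_length])
    have h1 : x ∈ {x : Cantor | ∀ n, ∃ m, ∀ k, x (idx n m (pref x k)) = false} ↔
        ∃ n, ∀ m, x ∈ G n m := by
      rw [hA]; simp
    have h2 : x ∈ {x : Cantor | ∀ n, ∃ m, ∀ k, x (idx n m (pref x k)) = false} ↔
        ¬ ∃ n, ∀ m, x ∈ G n m := by
      simp [key]
    tauto

lemma BoldSigma3.preimage {A : Set Cantor} (h : BoldSigma3 A) {f : Cantor → Cantor}
    (hf : Continuous f) : BoldSigma3 (f ⁻¹' A) := by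
  obtain ⟨G, hG, rfl⟩ := h
  exact ⟨fun n m => f ⁻¹' G n m, fun n m => (hG n m).preimage hf, by
    simp only [Set.preimage_iUnion, Set.preimage_iInter]⟩

lemma DIM_pi3 {U : List Bool →. List Bool} (hU : UniversalPF U) (α : ℝ) :
    BoldPi3 {X : Cantor | dimK U X = α} := by
  refine ⟨fun j m => {X | (∀ n ≥ m.unpair.1,
      α - 1 / ((j.unpair.1 : ℝ) + 1) ≤ (K U (pref X n) : ℝ) / n) ∧
      (m.unpair.2 ≥ j.unpair.2 ∧ (K U (pref X m.unpair.2) : ℝ) / (m.unpair.2 : ℕ) ≤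
        α + 1 / ((j.unpair.1 : ℝ) + 1))}, ?_, ?_⟩
  · intro j m
    simp only [Set.ofPred_and]
    refine IsClosed.inter ?_ (isClosed_pref (fun w => m.unpair.2 ≥ j.unpair.2 ∧
      (K U w : ℝ) / (m.unpair.2 : ℕ) ≤ α + 1 / ((j.unpair.1 : ℝ) + 1)) m.unpair.2)
    simp only [Set.ofPred_forall]
    refine isClosed_iInter fun n => isClosed_iInter fun _ => ?_
    exact isClosed_pref (fun w => α - 1 / ((j.unpair.1 : ℝ) + 1) ≤ (K U w : ℝ) / n) n
  · ext X
    simp only [Set.mem_ofPred_eq, Set.mem_iInter, Set.mem_iUnion]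
    rw [dimK_iff hU]
    constructor
    · rintro ⟨h1, h2⟩ j
      obtain ⟨a, ha⟩ := h1 j.unpair.1
      obtain ⟨b, hb⟩ := h2 j.unpair.1 j.unpair.2
      refine ⟨Nat.pair a b, ?_⟩
      rw [Nat.unpair_pair]
      exact ⟨ha, hb⟩
    · intro h
      constructor
      · intro k
        obtain ⟨m, hm, -⟩ := h (Nat.pair k 0)
        rw [Nat.unpair_pair] at hm
        exact ⟨_, hm⟩
      · intro k N
        obtain ⟨m, -, hm⟩ := h (Nat.pair k N)
        rw [Nat.unpair_pair] at hm
        exact ⟨_, hm⟩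

section reduction
variable (F : ℕ → ℕ → Set Cantor)

/-- The closed set `F n m` still looks alive at level `t`. -/
def alive (n m t : ℕ) (x : Cantor) : Prop := ∃ y ∈ F n m, ∀ j < t, y j = x j

lemma alive_anti {n m t t' : ℕ} {x : Cantor} (h : t ≤ t') (ha : alive F n m t' x) :
    alive F n m t x := by
  obtain ⟨y, h1, h2⟩ := ha
  exact ⟨y, h1, fun j hj => h2 j (by omega)⟩

lemma alive_congr {n m t : ℕ} {x x' : Cantor} (h : ∀ j < t, x' j = x j) :
    alive F n m t x' ↔ alive F n m t x := by
  unfold alive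
  refine exists_congr fun y => and_congr_right fun _ => forall₂_congr fun j hj => ?_
  rw [h j hj]

/-- Least index alive at level `t`. -/
noncomputable def cnt (n t : ℕ) (x : Cantor) : ℕ := sInf {m | t ≤ m ∨ alive F n m t x}

lemma cnt_mem (n t : ℕ) (x : Cantor) : t ≤ cnt F n t x ∨ alive F n (cnt F n t x) t x :=
  Nat.sInf_mem (s := {m | t ≤ m ∨ alive F n m t x}) ⟨t, Or.inl le_rfl⟩

lemma cnt_le {n t m : ℕ} {x : Cantor} (h : t ≤ m ∨ alive F n m t x) : cnt F n t x ≤ m :=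
  Nat.sInf_le h

lemma cnt_mono (n : ℕ) (x : Cantor) : Monotone (fun t => cnt F n t x) := by
  intro t t' h
  apply cnt_le
  rcases cnt_mem F n t' x with h1 | h1
  · exact Or.inl (h.trans h1)
  · exact Or.inr (alive_anti F h h1)

lemma cnt_congr {n t : ℕ} {x x' : Cantor} (h : ∀ j < t, x' j = x j) :
    cnt F n t x' = cnt F n t x := by
  unfold cnt
  simp only [alive_congr F h]

lemma stable_iff (hF : ∀ n m, IsClosed (F n m)) (n : ℕ) (x : Cantor) :
    (∃ m, x ∈ F n m) ↔ ∃ T, ∀ t ≥ T, cnt F n (t + 1) x = cnt F n t x := by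
  constructor
  · rintro ⟨m, hm⟩
    have hb : ∀ t, cnt F n t x ≤ m := fun t => cnt_le F (Or.inr ⟨x, hm, fun _ _ => rfl⟩)
    by_contra! hcon
    have : ∀ k, ∃ t, k ≤ cnt F n t x := by
      intro k
      induction k with
      | zero => exact ⟨0, Nat.zero_le _⟩
      | succ k ih =>
        obtain ⟨t, ht⟩ := ih
        obtain ⟨t', h1, h2⟩ := hcon t
        refine ⟨t' + 1, ?_⟩
        have h3 : cnt F n t x ≤ cnt F n t' x := cnt_mono F n x h1
        have h4 : cnt F n t' x ≤ cnt F n (t' + 1) x := cnt_mono F n x (Nat.le_succ t')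
        omega
    obtain ⟨t, ht⟩ := this (m + 1)
    have := hb t
    omega
  · rintro ⟨T, hT⟩
    have hc : ∀ t ≥ T, cnt F n t x = cnt F n T x := by
      intro t ht
      induction t, ht using Nat.le_induction with
      | base => rfl
      | succ t ht ih => rw [hT t ht, ih]
    refine ⟨cnt F n T x, ?_⟩
    by_contra hx
    obtain ⟨k, hk⟩ := PiNat.exists_disjoint_cylinder (hF n (cnt F n T x)) hx
    have hmem := cnt_mem F n (max (max k T) (cnt F n T x + 1)) x
    rw [hc (max (max k T) (cnt F n T x + 1)) (by omega)] at hmem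
    rcases hmem with h | h
    · omega
    · obtain ⟨y, h1, h2⟩ := alive_anti F (t := k) (by omega) h
      exact Set.disjoint_left.1 hk h1 (PiNat.mem_cylinder_iff.2 h2)

/-- Least row whose counter moves at time `t` (capped by `t`). -/
noncomputable def rowF (x : Cantor) (t : ℕ) : ℕ :=
  sInf {n | t ≤ n ∨ cnt F n (t + 1) x ≠ cnt F n t x}

lemma rowF_congr {t : ℕ} {x x' : Cantor} (h : ∀ j < t + 1, x' j = x j) :
    rowF F x' t = rowF F x t := by
  unfold rowF
  have : ∀ n, cnt F n (t + 1) x' = cnt F n (t + 1) x := fun n => cnt_congr F h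
  have h' : ∀ n, cnt F n t x' = cnt F n t x := fun n => cnt_congr F (fun j hj => h j (by omega))
  simp only [this, h']

lemma rowF_iff (hF : ∀ n m, IsClosed (F n m)) (x : Cantor) :
    (x ∈ ⋂ n, ⋃ m, F n m) ↔ ∀ v, ∃ T, ∀ t ≥ T, v < rowF F x t := by
  simp only [Set.mem_iInter, Set.mem_iUnion, stable_iff F hF]
  constructor
  · intro h v
    choose T hT using h
    refine ⟨(Finset.range (v + 1)).sup T + v + 1, fun t ht => ?_⟩
    by_contra! hle
    have hmem : rowF F x t ∈ {n | t ≤ n ∨ cnt F n (t + 1) x ≠ cnt F n t x} :=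
      Nat.sInf_mem ⟨t, Or.inl le_rfl⟩
    rcases hmem with h1 | h1
    · omega
    · have : T (rowF F x t) ≤ (Finset.range (v + 1)).sup T :=
        Finset.le_sup (Finset.mem_range.2 (by omega))
      exact h1 (hT _ t (by omega))
  · intro h n
    obtain ⟨T, hT⟩ := h n
    refine ⟨T, fun t ht => ?_⟩
    by_contra hne
    have : rowF F x t ≤ n := Nat.sInf_le (Or.inr hne)
    have := hT t ht
    omega

end reduction

lemma bld_congr {U : List Bool →. List Bool} (hU : PFMachine U) (α : ℝ) {r r' : ℕ → ℕ} {s : ℕ}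
    (h : ∀ t < s, r t = r' t) : bld hU α r s = bld hU α r' s := by
  induction s with
  | zero => rfl
  | succ s ih =>
    have ih' := ih (fun t ht => h t (by omega))
    have hl : r (Nat.log 2 s) = r' (Nat.log 2 s) :=
      h _ (Nat.lt_succ_of_le (Nat.log_le_self 2 s))
    rw [bld, bld, ih', hl]

lemma Wadge_hard {U : List Bool →. List Bool} (hU : UniversalPF U) {α : ℝ}
    (hα : α ∈ Set.Ioc (0 : ℝ) 1) (A : Set Cantor) (hA : BoldPi3 A) :
    ∃ f : Cantor → Cantor, Continuous f ∧ A = f ⁻¹' {X : Cantor | dimK U X = α} := by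
  obtain ⟨F, hF, rfl⟩ := hA
  refine ⟨fun x => Yseq hU.1 α (rowF F x), ?_, ?_⟩
  · refine continuous_pi fun i => ?_
    rw [continuous_def]
    intro s _
    apply isOpen_of_agree
    intro x hx
    refine ⟨i + 2, fun y hy => ?_⟩
    simp only [Set.mem_preimage, Yseq] at hx ⊢
    rw [bld_congr hU.1 α (r' := rowF F x)]
    · exact hx
    · intro t ht
      exact rowF_congr F (fun j hj => hy j (by omega))
  · ext x
    rw [rowF_iff F hF, Set.mem_preimage, Set.mem_ofPred_eq, dimK_Yseq hU hα]

/-- For every `α ∈ (0,1]`, the class `DIM^α = {X | dim(X) = α}` is Wadge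
complete for boldface Π⁰₃: it is boldface Π⁰₃ and every boldface Π⁰₃ set is the
preimage of `DIM^α` under a continuous self-map of Cantor space. Consequently
`DIM^α` is not boldface Σ⁰₃. -/
theorem DIM_Wadge_complete_Pi03 (U : List Bool →. List Bool)
    (hU : UniversalPF U) (α : ℝ) (hα : α ∈ Set.Ioc (0:ℝ) 1) :
    BoldPi3 {X : Cantor | dimK U X = α} ∧
    (∀ A : Set Cantor, BoldPi3 A → ∃ f : Cantor → Cantor,
        Continuous f ∧ A = f ⁻¹' {X : Cantor | dimK U X = α}) ∧
    ¬ BoldSigma3 {X : Cantor | dimK U X = α} := by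
  refine ⟨DIM_pi3 hU α, Wadge_hard hU hα, fun h => ?_⟩
  obtain ⟨A, hA, hA'⟩ := exists_pi3_not_sigma3
  obtain ⟨f, hf, rfl⟩ := Wadge_hard hU hα A hA
  exact hA' (h.preimage hf)
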